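/- Let N be an infinite, finitely generated nilpotent group with finite generating set S, and let S̄ denote the image of S in N/T(N). Then Farb_{N,S}(n) ≈ Farb_{N/T(N),S̄}(n). -/

import Mathlib

open Subgroup

/-- Word length of `g` with respect to a generating set `S`: the least length of a word in
`S ∪ S⁻¹` representing `g`. -/
noncomputable def wordLength {G : Type*} [Group G] (S : Set G) (g : G) : ℕ :=
  sInf {n : ℕ | ∃ w : List G, w.length = n ∧ (∀ x ∈ w, x ∈ S ∨ x⁻¹ ∈ S) ∧ w.prod = g}

/-- The depth `D_G(g)`: the minimal order of a finite group admitting a surjective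
homomorphism from `G` that does not kill `g`. -/
noncomputable def depthFn {G : Type*} [Group G] (g : G) : ℕ :=
  sInf {n : ℕ | ∃ (Q : Type) (_ : Group Q) (_ : Fintype Q) (φ : G →* Q),
    Function.Surjective φ ∧ φ g ≠ 1 ∧ Fintype.card Q = n}

/-- The residual finiteness function `Farb_{G,S}(n)`: the maximum of `D_G(g)` over nontrivial
`g` of word length at most `n`. -/
noncomputable def Farb {G : Type*} [Group G] (S : Set G) (n : ℕ) : ℕ :=
  sSup {d : ℕ | ∃ g : G, g ≠ 1 ∧ wordLength S g ≤ n ∧ depthFn g = d}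

/-- `f ≾ g` : there is a constant `C > 0` with `f n ≤ C * g (C * n)` for all `n`. -/
def Precsim (f g : ℕ → ℕ) : Prop := ∃ C : ℕ, 0 < C ∧ ∀ n, f n ≤ C * g (C * n)

/-- `f ≈ g` : `f ≾ g` and `g ≾ f`. -/
def AsympEquiv (f g : ℕ → ℕ) : Prop := Precsim f g ∧ Precsim g f

namespace Subgroup

variable {G : Type*} [Group G]

/-- Generators of the image of `H` under `f` lift to elements of `H` that generate `H` up to the
kernel of `f`. -/
theorem exists_finite_le_closure_sup_ker {G' : Type*} [Group G'] (f : G →* G') (H : Subgroup G)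
    (h : (H.map f).FG) : ∃ A ⊆ (H : Set G), A.Finite ∧ H ≤ closure A ⊔ f.ker := by
  obtain ⟨S, hS, hfin⟩ := (Subgroup.fg_iff _).1 h
  have hsub : S ⊆ f '' (H : Set G) := by
    rw [← coe_map, ← hS]
    exact subset_closure
  obtain ⟨A, hA, hAfin, hAS⟩ := Set.exists_subset_image_finite_and
    (p := fun t => closure t = H.map f) |>.1 ⟨S, hsub, hfin, hS⟩
  refine ⟨A, hA, hAfin, ?_⟩
  rw [← comap_map_eq, f.map_closure, hAS]
  exact le_comap_map f H

/-- A subgroup of a finitely generated central subgroup is finitely generated. -/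
theorem FG.of_le_of_le_center {K L : Subgroup G} (hK : K.FG) (hKc : K ≤ center G) (hL : L ≤ K) :
    L.FG := by
  let _ : CommGroup K :=
    { (inferInstance : Group K) with
      mul_comm := fun a b => Subtype.ext (((mem_center_iff.1 (hKc a.2)) b).symm) }
  have : Group.FG K := (Group.fg_iff_subgroup_fg K).2 hK
  have : Module.Finite ℤ (Additive K) := Module.Finite.iff_addGroup_fg.2 inferInstance
  have hfg : (L.subgroupOf K).FG := by
    rw [Subgroup.fg_iff_add_fg]
    have := IsNoetherian.noetherian (R := ℤ)
      (AddSubgroup.toIntSubmodule (L.subgroupOf K).toAddSubgroup)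
    rwa [Submodule.fg_iff_addSubgroup_fg] at this
  have : Group.FG (L.subgroupOf K) := (Group.fg_iff_subgroup_fg _).2 hfg
  have : Group.FG L := Group.fg_of_surjective
    (f := (subgroupOfEquivOfLe hL).toMonoidHom) (subgroupOfEquivOfLe hL).surjective
  exact (Group.fg_iff_subgroup_fg L).1 this

theorem normal_of_le_center {K : Subgroup G} (hK : K ≤ center G) : K.Normal where
  conj_mem n hn g := by
    rw [mem_center_iff.1 (hK hn) g, mul_inv_cancel_right]
    exact hn

end Subgroup

namespace Group

open scoped commutatorElement IsMulCommutative

variable {G : Type*} [Group G]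

/-- Subgroups are finitely generated in an extension whose kernel and quotient have this
property. -/
theorem subgroup_fg_of_quotient (K : Subgroup G) [K.Normal] (hK : ∀ L ≤ K, L.FG)
    (hQ : ∀ L : Subgroup (G ⧸ K), L.FG) (H : Subgroup G) : H.FG := by
  obtain ⟨A, hA, hfin, hle⟩ :=
    H.exists_finite_le_closure_sup_ker (QuotientGroup.mk' K) (hQ _)
  rw [QuotientGroup.ker_mk'] at hle
  have hAH : closure A ≤ H := (closure_le H).2 hA
  have : H = closure A ⊔ (K ⊓ H) := by
    refine le_antisymm (fun x hx => ?_) (sup_le hAH inf_le_right)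
    obtain ⟨a, ha, k, hk, rfl⟩ := mem_sup_of_normal_right.1 (hle hx)
    exact mul_mem_sup ha ⟨hk, (H.mul_mem_cancel_left (hAH ha)).1 hx⟩
  rw [this]
  exact Subgroup.FG.sup ((Subgroup.fg_iff _).2 ⟨A, rfl, hfin⟩) (hK _ inf_le_left)

/-- In a finitely generated group, a central term of the lower central series is finitely
generated as soon as subgroups of the quotient by it are. -/
theorem lowerCentralSeries_fg [Group.FG G] (n : ℕ)
    (hc : (⊤ : Subgroup G).lowerCentralSeries n ≤ center G)
    (hQ : ∀ L : Subgroup (G ⧸ (⊤ : Subgroup G).lowerCentralSeries n), L.FG) :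
    ((⊤ : Subgroup G).lowerCentralSeries n).FG := by
  cases n with
  | zero => exact Group.fg_def.1 inferInstance
  | succ d =>
    obtain ⟨S, hS, hSfin⟩ := Group.fg_iff.1 (inferInstance : Group.FG G)
    set K := (⊤ : Subgroup G).lowerCentralSeries (d + 1) with hKdef
    obtain ⟨A, hA, hAfin, hle⟩ := exists_finite_le_closure_sup_ker
      (QuotientGroup.mk' K) ((⊤ : Subgroup G).lowerCentralSeries d) (hQ _)
    rw [QuotientGroup.ker_mk'] at hle
    let L := closure (Set.image2 (fun a s => ⁅a, s⁆) A S)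
    have hLK : L ≤ K := by
      refine (closure_le K).2 ?_
      rintro _ ⟨a, ha, s, -, rfl⟩
      exact commutator_mem_commutator (hA ha) (mem_top s)
    have : L.Normal := normal_of_le_center (hLK.trans hc)
    have hcen : (⊤ : Subgroup G).lowerCentralSeries d ≤
        (center (G ⧸ L)).comap (QuotientGroup.mk' L) := by
      refine hle.trans (sup_le ((closure_le _).2 fun a ha => ?_) fun k hk => ?_)
      · have : (⊤ : Subgroup G) ≤
            (centralizer {(QuotientGroup.mk' L) a}).comap (QuotientGroup.mk' L) := by
          rw [← hS, closure_le]
          intro s hs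
          simp only [coe_comap, Set.mem_preimage, SetLike.mem_coe, mem_centralizer_singleton_iff]
          have h : ⁅a, s⁆ ∈ L := subset_closure ⟨a, ha, s, hs, rfl⟩
          have h1 := (QuotientGroup.eq_one_iff (N := L) _).2 h
          exact (commutatorElement_eq_one_iff_mul_comm.1 h1).symm
        refine mem_center_iff.2 fun q => ?_
        obtain ⟨g, rfl⟩ := QuotientGroup.mk'_surjective L q
        exact mem_centralizer_singleton_iff.1 (this (mem_top g))
      · refine mem_center_iff.2 fun q => ?_
        obtain ⟨g, rfl⟩ := QuotientGroup.mk'_surjective L q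
        rw [← map_mul, ← map_mul, mem_center_iff.1 (hc hk) g]
    have hKL : K ≤ L := by
      rw [hKdef, Subgroup.lowerCentralSeries_succ, commutator_le]
      intro x hx g _
      have h := mem_center_iff.1 (hcen hx) (QuotientGroup.mk' L g)
      exact (QuotientGroup.eq_one_iff (N := L) _).1
        (commutatorElement_eq_one_iff_mul_comm.2 h.symm)
    rw [le_antisymm hKL hLK]
    exact (Subgroup.fg_iff _).2 ⟨_, rfl, hAfin.image2 _ hSfin⟩

/-- Finitely generated nilpotent groups are Noetherian: all their subgroups are finitely
generated. -/
theorem IsNilpotent.subgroup_fg [Group.FG G] [hG : Group.IsNilpotent G] (H : Subgroup G) :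
    H.FG := by
  obtain ⟨n, hn⟩ := Subgroup.nilpotent_iff_lowerCentralSeries.1 hG
  clear hG
  induction n generalizing G with
  | zero =>
    have : H = ⊥ := le_bot_iff.1 (le_top.trans hn.le)
    exact this ▸ Subgroup.FG.bot
  | succ n ih =>
    have hc : (⊤ : Subgroup G).lowerCentralSeries n ≤ center G := by
      intro x hx
      refine mem_center_iff.2 fun g => ?_
      have : ⁅x, g⁆ ∈ (⊤ : Subgroup G).lowerCentralSeries (n + 1) :=
        commutator_mem_commutator hx (mem_top g)
      rw [hn, mem_bot] at this
      exact (commutatorElement_eq_one_iff_mul_comm.1 this).symm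
    have hQ (L : Subgroup (G ⧸ (⊤ : Subgroup G).lowerCentralSeries n)) : L.FG := by
      apply ih
      have := map_lowerCentralSeries ⊤ (QuotientGroup.mk' ((⊤ : Subgroup G).lowerCentralSeries n)) n
      rw [map_top_of_surjective _ (QuotientGroup.mk'_surjective _)] at this
      rw [← this, Subgroup.map_eq_bot_iff, QuotientGroup.ker_mk']
    have hfg := lowerCentralSeries_fg n hc hQ
    exact subgroup_fg_of_quotient _ (fun L hL => hfg.of_le_of_le_center hc hL) hQ H

/-- A finitely generated nilpotent torsion group is finite. -/
theorem IsNilpotent.finite_of_isMulTorsion [Group.FG G] [Group.IsNilpotent G]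
    (h : IsMulTorsion G) : Finite G := by
  suffices Group.FG G → IsMulTorsion G → Finite G from this ‹_› h
  clear h ‹Group.FG G›
  apply Group.nilpotent_center_quotient_ind
    (P := fun G _ _ => Group.FG G → IsMulTorsion G → Finite G)
  · intro G _ _ _ _
    infer_instance
  · intro G _ _ ih hfg htor
    have : Finite (G ⧸ center G) := ih inferInstance
      (IsMulTorsion.of_surjective (QuotientGroup.mk'_surjective _) htor)
    have : Group.FG (center G) := (Group.fg_iff_subgroup_fg _).2 (IsNilpotent.subgroup_fg _)
    have : Finite (center G) := CommGroup.finite_of_fg_isMulTorsion _ (htor.subgroup _)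
    exact Finite.of_subgroup_quotient (center G)

/-- A nilpotent group whose center has finite exponent is a torsion group. -/
theorem IsNilpotent.isMulTorsion_of_center [Group.IsNilpotent G] {m : ℕ} (hm : 0 < m)
    (h : ∀ z ∈ center G, z ^ m = 1) : IsMulTorsion G := by
  revert h
  apply Group.nilpotent_center_quotient_ind
    (P := fun G _ _ => (∀ z ∈ center G, z ^ m = 1) → IsMulTorsion G)
  · intro G _ _ _ g
    rw [Subsingleton.elim g 1]
    exact IsOfFinOrder.one
  · intro G _ _ ih h g
    have htor : IsMulTorsion (G ⧸ center G) := by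
      refine ih fun z hz => ?_
      obtain ⟨x, rfl⟩ := QuotientGroup.mk'_surjective _ z
      rw [← map_pow]
      refine (QuotientGroup.eq_one_iff _).2 (mem_center_iff.2 fun g => ?_)
      have hcomm : x⁻¹ * (g * x * g⁻¹) ∈ center G := by
        refine QuotientGroup.eq.1 (eq_mul_inv_of_mul_eq (?_ : (x * g : G ⧸ center G) = g * x))
        exact (mem_center_iff.1 hz (QuotientGroup.mk g)).symm
      have hconj : g * x * g⁻¹ = x * (x⁻¹ * (g * x * g⁻¹)) := (mul_inv_cancel_left _ _).symm
      have hpow : g * x ^ m * g⁻¹ = x ^ m := by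
        rw [← conj_pow, hconj, Commute.mul_pow (mem_center_iff.1 hcomm x), h _ hcomm, mul_one]
      exact mul_inv_eq_iff_eq_mul.1 hpow
    obtain ⟨k, hk, hgk⟩ := isOfFinOrder_iff_pow_eq_one.1 (htor (QuotientGroup.mk g))
    have hc : g ^ k ∈ center G := (QuotientGroup.eq_one_iff _).1 hgk
    exact isOfFinOrder_iff_pow_eq_one.2
      ⟨k * m, Nat.mul_pos hk hm, by rw [pow_mul, h _ hc]⟩

/-- A finitely generated nilpotent group is finite if some nontrivial element lies in all of its
nontrivial normal subgroups. -/
theorem IsNilpotent.finite_of_forall_mem_normal [Group.FG G] [Group.IsNilpotent G] {g : G}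
    (hg : g ≠ 1) (h : ∀ M : Subgroup G, M.Normal → M ≠ ⊥ → g ∈ M) : Finite G := by
  have htor : IsMulTorsion (center G) := by
    rintro ⟨z, hz⟩
    by_contra hinf
    rw [← Submonoid.isOfFinOrder_coe (H := (center G).toSubmonoid),
      ← injective_zpow_iff_not_isOfFinOrder] at hinf
    have hpow (k : ℤ) (hk : k ≠ 0) : g ∈ zpowers (z ^ k) := by
      refine h _ (normal_of_le_center ?_) ?_
      · exact (zpowers_le).2 (zpow_mem hz k)
      · rw [Ne, zpowers_eq_bot]
        exact fun h0 => hk (hinf (by simpa using h0))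
    obtain ⟨k, hk⟩ := mem_zpowers_iff.1 (hpow 1 one_ne_zero)
    rw [zpow_one] at hk
    have hk0 : k ≠ 0 := by
      rintro rfl
      exact hg (by simpa using hk.symm)
    obtain ⟨j, hj⟩ := mem_zpowers_iff.1 (hpow (2 * k) (mul_ne_zero two_ne_zero hk0))
    rw [← zpow_mul, ← hk] at hj
    have heq : 2 * k * j = k := hinf hj
    have : 2 * j = 1 := mul_left_cancel₀ hk0 (by linarith)
    omega
  have : Group.FG (center G) := (Group.fg_iff_subgroup_fg _).2 (IsNilpotent.subgroup_fg _)
  have : Finite (center G) := CommGroup.finite_of_fg_isMulTorsion _ htor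
  refine IsNilpotent.finite_of_isMulTorsion
    (IsNilpotent.isMulTorsion_of_center (m := Nat.card (center G)) Nat.card_pos fun z hz => ?_)
  exact congrArg Subtype.val (pow_card_eq_one' (x := (⟨z, hz⟩ : center G)))

/-- Any nontrivial element of a group avoids a normal subgroup that is maximal for this
property. -/
theorem exists_maximal_normal_notMem {g : G} (hg : g ≠ 1) :
    ∃ M : Subgroup G, Maximal (fun M => M.Normal ∧ g ∉ M) M := by
  have hzorn := zorn_le_nonempty₀ {M : Subgroup G | M.Normal ∧ g ∉ M}
    (fun c hc hchain M₀ hM₀ => ⟨sSup c, ⟨sSup_normal c fun H hH => (hc hH).1, fun hmem => ?_⟩,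
      fun H hH => le_sSup hH⟩) ⊥ ⟨inferInstance, by simpa using hg⟩
  · exact hzorn.imp fun M hM => hM.2
  · obtain ⟨H, hH, hgH⟩ := (mem_sSup_of_directedOn ⟨M₀, hM₀⟩ hchain.directedOn).1 hmem
    exact (hc hH).2 hgH

/-- Finitely generated nilpotent groups are residually finite. -/
theorem IsNilpotent.exists_finiteIndex_notMem [Group.FG G] [Group.IsNilpotent G] {g : G}
    (hg : g ≠ 1) : ∃ M : Subgroup G, M.Normal ∧ M.FiniteIndex ∧ g ∉ M := by
  obtain ⟨M, hM⟩ := exists_maximal_normal_notMem hg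
  have hMn : M.Normal := hM.prop.1
  refine ⟨M, hMn, ?_, hM.prop.2⟩
  have : Finite (G ⧸ M) := by
    refine IsNilpotent.finite_of_forall_mem_normal (g := (g : G ⧸ M))
      (fun h => hM.prop.2 ((QuotientGroup.eq_one_iff g).1 h)) fun K hK hK0 => ?_
    by_contra hgK
    refine hK0 ((comap_injective (QuotientGroup.mk'_surjective M)).eq_iff.1 ?_)
    rw [MonoidHom.comap_bot, QuotientGroup.ker_mk']
    have hle : M ≤ K.comap (QuotientGroup.mk' M) := by
      simpa using (QuotientGroup.mk' M).ker_le_comap K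
    exact (hM.eq_of_le ⟨hK.comap (QuotientGroup.mk' M), hgK⟩ hle).symm
  exact finiteIndex_of_finite_quotient

end Group

section wordLength

variable {G : Type*} [Group G] {S : Set G}

theorem wordLength_le_length {w : List G} (hw : ∀ x ∈ w, x ∈ S ∨ x⁻¹ ∈ S) :
    wordLength S w.prod ≤ w.length :=
  Nat.sInf_le ⟨w, rfl, hw, rfl⟩

theorem exists_length_eq_wordLength (hS : closure S = ⊤) (g : G) :
    ∃ w : List G, w.length = wordLength S g ∧ (∀ x ∈ w, x ∈ S ∨ x⁻¹ ∈ S) ∧ w.prod = g := by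
  have hg : g ∈ Submonoid.closure (S ∪ S⁻¹) := by
    rw [← closure_toSubmonoid, hS]
    exact mem_top g
  obtain ⟨w, hw, hprod⟩ := Submonoid.exists_list_of_mem_closure hg
  exact Nat.sInf_mem (s := {n : ℕ | ∃ w : List G, w.length = n ∧
    (∀ x ∈ w, x ∈ S ∨ x⁻¹ ∈ S) ∧ w.prod = g}) ⟨_, w, rfl, hw, hprod⟩

theorem wordLength_one : wordLength S 1 = 0 :=
  Nat.le_zero.1 (wordLength_le_length (w := []) (by simp))

theorem wordLength_le_one {s : G} (hs : s ∈ S) : wordLength S s ≤ 1 := by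
  simpa using wordLength_le_length (S := S) (w := [s]) (by simp [hs])

theorem wordLength_mul_le (hS : closure S = ⊤) (g h : G) :
    wordLength S (g * h) ≤ wordLength S g + wordLength S h := by
  obtain ⟨v, hv, hvS, rfl⟩ := exists_length_eq_wordLength hS g
  obtain ⟨w, hw, hwS, rfl⟩ := exists_length_eq_wordLength hS h
  rw [← hv, ← hw, ← List.prod_append, ← List.length_append]
  refine wordLength_le_length fun x hx => ?_
  exact (List.mem_append.1 hx).elim (hvS x) (hwS x)

theorem wordLength_pow_le (hS : closure S = ⊤) (g : G) (m : ℕ) :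
    wordLength S (g ^ m) ≤ m * wordLength S g := by
  induction m with
  | zero => simp [wordLength_one]
  | succ m ih =>
    rw [pow_succ, Nat.succ_mul]
    exact (wordLength_mul_le hS _ _).trans (Nat.add_le_add_right ih _)

theorem wordLength_image_le {G' : Type*} [Group G'] (f : G →* G') (hS : closure S = ⊤) (g : G) :
    wordLength (f '' S) (f g) ≤ wordLength S g := by
  obtain ⟨w, hw, hwS, rfl⟩ := exists_length_eq_wordLength hS g
  rw [← hw, map_list_prod, ← List.length_map f]
  refine wordLength_le_length fun x hx => ?_
  obtain ⟨y, hy, rfl⟩ := List.mem_map.1 hx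
  refine (hwS y hy).imp (Set.mem_image_of_mem f) fun h => ?_
  rw [← map_inv]
  exact Set.mem_image_of_mem f h

/-- Every element of the group generated by `f '' S` lifts along `f` to an element that is not
longer. -/
theorem exists_wordLength_le_of_image {G' : Type*} [Group G'] (f : G →* G')
    (hS : closure (f '' S) = ⊤) (q : G') :
    ∃ g : G, f g = q ∧ wordLength S g ≤ wordLength (f '' S) q := by
  obtain ⟨w, hw, hwS, rfl⟩ := exists_length_eq_wordLength hS q
  have hlift : ∀ x ∈ w, ∃ y : G, f y = x ∧ (y ∈ S ∨ y⁻¹ ∈ S) := by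
    intro x hx
    rcases hwS x hx with ⟨y, hy, rfl⟩ | ⟨y, hy, hyx⟩
    · exact ⟨y, rfl, Or.inl hy⟩
    · exact ⟨y⁻¹, by rw [map_inv, hyx, inv_inv], Or.inr (by rwa [inv_inv])⟩
  choose! l hl hlS using hlift
  refine ⟨(w.map l).prod, ?_, ?_⟩
  · rw [map_list_prod, List.map_map, List.map_congr_left (f := f ∘ l) (g := id) hl,
      List.map_id]
  · rw [← hw, ← List.length_map l]
    refine wordLength_le_length fun y hy => ?_
    obtain ⟨x, hx, rfl⟩ := List.mem_map.1 hy
    exact hlS x hx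

theorem finite_setOf_wordLength_le (hfin : S.Finite) (hS : closure S = ⊤) (n : ℕ) :
    {g : G | wordLength S g ≤ n}.Finite := by
  let A : Set G := S ∪ S⁻¹
  have : Finite A := (hfin.union hfin.inv).to_subtype
  refine ((List.finite_length_le A n).image fun w => (w.map Subtype.val).prod).subset ?_
  intro g hg
  obtain ⟨w, hw, hwS, rfl⟩ := exists_length_eq_wordLength hS g
  lift w to List A using hwS
  exact ⟨w, by simpa using hw.trans_le hg, rfl⟩

end wordLength

section depthFn

variable {G : Type*} [Group G] {g : G}

theorem exists_surjective_card_eq_index (M : Subgroup G) [M.Normal] [M.FiniteIndex]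
    (hg : g ∉ M) : ∃ (Q : Type) (_ : Group Q) (_ : Fintype Q) (φ : G →* Q),
      Function.Surjective φ ∧ φ g ≠ 1 ∧ Fintype.card Q = M.index := by
  let e := Shrink.mulEquiv.{0} (α := G ⧸ M)
  refine ⟨Shrink.{0} (G ⧸ M), inferInstance, Fintype.ofFinite _,
    e.symm.toMonoidHom.comp (QuotientGroup.mk' M),
    e.symm.surjective.comp (QuotientGroup.mk'_surjective M), fun h => hg ?_, ?_⟩
  · rw [← QuotientGroup.eq_one_iff]
    exact e.symm.map_eq_one_iff.1 h
  · rw [Fintype.card_eq_nat_card, Nat.card_congr e.toEquiv, index]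

theorem depthFn_le_index (M : Subgroup G) [M.Normal] [M.FiniteIndex] (hg : g ∉ M) :
    depthFn g ≤ M.index :=
  Nat.sInf_le (exists_surjective_card_eq_index M hg)

theorem exists_index_eq_depthFn
    (h : ∃ M : Subgroup G, M.Normal ∧ M.FiniteIndex ∧ g ∉ M) :
    ∃ M : Subgroup G, M.Normal ∧ M.FiniteIndex ∧ g ∉ M ∧ M.index = depthFn g := by
  obtain ⟨M, _, _, hgM⟩ := h
  have hne : {n : ℕ | ∃ (Q : Type) (_ : Group Q) (_ : Fintype Q) (φ : G →* Q),
      Function.Surjective φ ∧ φ g ≠ 1 ∧ Fintype.card Q = n}.Nonempty :=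
    ⟨M.index, exists_surjective_card_eq_index M hgM⟩
  obtain ⟨Q, _, _, φ, hφ, hφg, hcard⟩ := Nat.sInf_mem hne
  have hidx : φ.ker.index = Fintype.card Q := by
    rw [index_ker, MonoidHom.range_eq_top.2 hφ, card_top, Nat.card_eq_fintype_card]
  refine ⟨φ.ker, inferInstance, ⟨?_⟩, hφg, hidx.trans hcard⟩
  rw [hidx]
  exact Fintype.card_ne_zero

theorem depthFn_le_Farb {S : Set G} (hfin : S.Finite) (hS : closure S = ⊤) {n : ℕ} (hg : g ≠ 1)
    (hn : wordLength S g ≤ n) : depthFn g ≤ Farb S n := by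
  refine le_csSup (Set.Finite.bddAbove ?_) ⟨g, hg, hn, rfl⟩
  refine ((finite_setOf_wordLength_le hfin hS n).image depthFn).subset ?_
  rintro _ ⟨h, -, hh, rfl⟩
  exact ⟨h, hh, rfl⟩

theorem Farb_le {S : Set G} {n d : ℕ}
    (h : ∀ g : G, g ≠ 1 → wordLength S g ≤ n → depthFn g ≤ d) : Farb S n ≤ d := by
  refine csSup_le' ?_
  rintro _ ⟨g, hg, hn, rfl⟩
  exact h g hg hn

theorem one_le_Farb [Nontrivial G] {S : Set G} (hfin : S.Finite) (hS : closure S = ⊤)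
    (hrf : ∀ g : G, g ≠ 1 → ∃ M : Subgroup G, M.Normal ∧ M.FiniteIndex ∧ g ∉ M)
    {n : ℕ} (hn : 1 ≤ n) : 1 ≤ Farb S n := by
  obtain ⟨s, hs, hs1⟩ : ∃ s ∈ S, s ≠ 1 := by
    by_contra! h
    exact bot_ne_top ((closure_eq_bot_iff.2 h).symm.trans hS)
  obtain ⟨M, _, hM, -, hidx⟩ := exists_index_eq_depthFn (hrf s hs1)
  refine le_trans ?_ (depthFn_le_Farb hfin hS hs1 ((wordLength_le_one hs).trans hn))
  rw [← hidx]
  exact Nat.one_le_iff_ne_zero.2 hM.index_ne_zero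

/-- Depth does not increase when an element with nontrivial image is lifted along a
surjection onto a group whose finite quotients detect the image. -/
theorem depthFn_le_depthFn_map {G' : Type*} [Group G'] {f : G →* G'} (hf : Function.Surjective f)
    (h : ∃ M : Subgroup G', M.Normal ∧ M.FiniteIndex ∧ f g ∉ M) : depthFn g ≤ depthFn (f g) := by
  obtain ⟨M, hM, hMfin, hgM, hidx⟩ := exists_index_eq_depthFn h
  have hcomap := index_comap_of_surjective M hf
  have := hM.comap f
  have : (M.comap f).FiniteIndex := ⟨hcomap ▸ hMfin.index_ne_zero⟩
  rw [← hidx, ← hcomap]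
  exact depthFn_le_index _ hgM

/-- If the kernel of a surjection `f` has exponent dividing `m`, the depth of `f g` is at most
that of `g ^ m`, provided `g ^ m` is detected by some finite quotient. -/
theorem depthFn_map_le_depthFn_pow {G' : Type*} [Group G'] {f : G →* G'}
    (hf : Function.Surjective f) {m : ℕ} (hm : ∀ t ∈ f.ker, t ^ m = 1)
    (h : ∃ M : Subgroup G, M.Normal ∧ M.FiniteIndex ∧ g ^ m ∉ M) :
    depthFn (f g) ≤ depthFn (g ^ m) := by
  obtain ⟨M, hM, hMfin, hgM, hidx⟩ := exists_index_eq_depthFn h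
  have hdvd := index_map_dvd M hf
  have := hM.map f hf
  have : (M.map f).FiniteIndex := ⟨ne_zero_of_dvd_ne_zero hMfin.index_ne_zero hdvd⟩
  rw [← hidx]
  refine (depthFn_le_index (M.map f) ?_).trans
    (Nat.le_of_dvd (Nat.pos_of_ne_zero hMfin.index_ne_zero) hdvd)
  rintro ⟨a, ha, hag⟩
  have hker : a⁻¹ * g ∈ f.ker := by
    rw [MonoidHom.mem_ker, map_mul, map_inv, hag, inv_mul_cancel]
  have hmk : (g : G ⧸ M) = (a⁻¹ * g : G) := by
    rw [QuotientGroup.mk_mul, (QuotientGroup.eq_one_iff a⁻¹).2 (inv_mem ha), one_mul]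
  refine hgM ((QuotientGroup.eq_one_iff _).1 ?_)
  rw [QuotientGroup.mk_pow, hmk, ← QuotientGroup.mk_pow, hm _ hker, QuotientGroup.mk_one]

end depthFn

/-- Let `N` be an infinite, finitely generated nilpotent group with finite generating set `S`,
let `T = T(N)` be its torsion subgroup, and let `S̄` be the image of `S` in `N/T(N)`.  Then
`Farb_{N,S}(n) ≈ Farb_{N/T(N),S̄}(n)`. -/
theorem stmt8 (N : Type*) [Group N] [Group.IsNilpotent N] [Infinite N]
    (S : Set N) (hS : S.Finite) (hgen : Subgroup.closure S = ⊤)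
    (T : Subgroup N) (hT : T.Normal) (hTtor : ∀ g : N, g ∈ T ↔ IsOfFinOrder g) :
    AsympEquiv (Farb S) (Farb ((QuotientGroup.mk' T) '' S)) := by
  have : Group.FG N := Group.fg_iff.2 ⟨S, hgen, hS⟩
  have : Group.FG T := (Group.fg_iff_subgroup_fg T).2 (Group.IsNilpotent.subgroup_fg T)
  have hTfin : Finite T := Group.IsNilpotent.finite_of_isMulTorsion fun t =>
    (Submonoid.isOfFinOrder_coe (H := T.toSubmonoid)).1 ((hTtor t).1 t.2)
  have hsurj := QuotientGroup.mk'_surjective T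
  have : Nontrivial (N ⧸ T) := by
    by_contra h
    rw [not_nontrivial_iff_subsingleton] at h
    exact not_finite_iff_infinite.2 ‹Infinite N› (Finite.of_subgroup_quotient T)
  have hfin : ((QuotientGroup.mk' T) '' S).Finite := hS.image _
  have hgen' : closure ((QuotientGroup.mk' T) '' S) = ⊤ := by
    rw [← MonoidHom.map_closure, hgen, map_top_of_surjective _ hsurj]
  have hrf (q : N ⧸ T) (hq : q ≠ 1) := Group.IsNilpotent.exists_finiteIndex_notMem hq
  constructor
  · obtain ⟨B, hB⟩ := ((T : Set N).toFinite.image depthFn).bddAbove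
    refine ⟨B + 1, B.succ_pos, fun n => Farb_le fun g hg hn => ?_⟩
    have hn1 : 1 ≤ n := by
      by_contra! h0
      obtain ⟨w, hw, -, rfl⟩ := exists_length_eq_wordLength hgen g
      have : w = [] := List.length_eq_zero_iff.1 (by omega)
      exact hg (by rw [this, List.prod_nil])
    by_cases hgT : g ∈ T
    · calc depthFn g ≤ B + 1 := (hB ⟨g, hgT, rfl⟩).trans B.le_succ
        _ ≤ (B + 1) * Farb ((QuotientGroup.mk' T) '' S) ((B + 1) * n) :=
          Nat.le_mul_of_pos_right _
            (one_le_Farb hfin hgen' hrf (Nat.mul_pos B.succ_pos hn1))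
    · have hq : QuotientGroup.mk' T g ≠ 1 := fun h => hgT ((QuotientGroup.eq_one_iff g).1 h)
      calc depthFn g ≤ depthFn (QuotientGroup.mk' T g) := depthFn_le_depthFn_map hsurj (hrf _ hq)
        _ ≤ Farb ((QuotientGroup.mk' T) '' S) ((B + 1) * n) :=
          depthFn_le_Farb hfin hgen' hq (((wordLength_image_le _ hgen g).trans hn).trans
            (Nat.le_mul_of_pos_left n B.succ_pos))
        _ ≤ (B + 1) * Farb ((QuotientGroup.mk' T) '' S) ((B + 1) * n) :=
          Nat.le_mul_of_pos_left _ B.succ_pos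
  · have hm : 0 < Nat.card T := Nat.card_pos
    refine ⟨Nat.card T, hm, fun n => Farb_le fun q hq hn => ?_⟩
    obtain ⟨g, rfl, hg⟩ := exists_wordLength_le_of_image _ hgen' q
    have hpow : g ^ Nat.card T ≠ 1 := by
      intro h
      exact hq ((QuotientGroup.eq_one_iff g).2
        ((hTtor g).2 (isOfFinOrder_iff_pow_eq_one.2 ⟨_, hm, h⟩)))
    have hexp : ∀ t ∈ (QuotientGroup.mk' T).ker, t ^ Nat.card T = 1 := by
      intro t ht
      rw [QuotientGroup.ker_mk'] at ht
      exact congrArg Subtype.val (pow_card_eq_one' (x := (⟨t, ht⟩ : T)))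
    calc depthFn (QuotientGroup.mk' T g) ≤ depthFn (g ^ Nat.card T) :=
          depthFn_map_le_depthFn_pow hsurj hexp (Group.IsNilpotent.exists_finiteIndex_notMem hpow)
      _ ≤ Farb S (Nat.card T * n) :=
          depthFn_le_Farb hS hgen hpow ((wordLength_pow_le hgen g _).trans
            (Nat.mul_le_mul_left _ (hg.trans hn)))
      _ ≤ Nat.card T * Farb S (Nat.card T * n) := Nat.le_mul_of_pos_left _ hm
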